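/- Let C = A_1 ⊓ ⋯ ⊓ A_m ⊓ ⨅_{1≤i≤n} (≥ k_i R_i.C_i) and C' = A'_1 ⊓ ⋯ ⊓ A'_{m'} ⊓ ⨅_{1≤j≤n'} (≥ k'_j R'_j.C'_j) be L(≥,⊓,⊤)-concepts (with m, n, m', n' ≥ 0, the empty conjunction denoting ⊤). Then the following are equivalent: (1) ⊨ C ⊑ C'; (2) {A'_1,…,A'_{m'}} ⊆ {A_1,…,A_m}, and for every j ≤ n' there is an i ≤ n such that k_i ≥ k'_j, R_i = R'_j, and ⊨ C_i ⊑ C'_j. -/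

import Mathlib

namespace DL

/-! ### Syntax of ALCQI concepts -/

/-- Roles: role names (indexed by ℕ) and inverse roles. -/
inductive Role where
  | name : ℕ → Role
  | inv  : ℕ → Role
deriving DecidableEq

/-- ALCQI concept expressions. -/
inductive Concept where
  | atom : ℕ → Concept
  | top  : Concept
  | bot  : Concept
  | and  : Concept → Concept → Concept
  | or   : Concept → Concept → Concept
  | neg  : Concept → Concept
  | ex   : Role → Concept → Concept
  | all  : Role → Concept → Concept
  | atLeast : ℕ → Role → Concept → Concept
deriving DecidableEq

/-- The operators/constructors that a concept language may use. -/
inductive Op where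
  | all | ex | ge | inv | and | or | top | bot | neg
deriving DecidableEq

/-! ### Interpretations and semantics -/

/-- An interpretation: a nonempty domain, interpretations of concept names
and of role names. -/
structure Interp where
  Δ : Type
  dom_nonempty : Nonempty Δ
  atom : ℕ → Set Δ
  rel : ℕ → Δ → Δ → Prop

def Role.sem (I : Interp) : Role → (I.Δ → I.Δ → Prop)
  | .name R => I.rel R
  | .inv R  => fun d e => I.rel R e d

def Concept.sem (I : Interp) : Concept → Set I.Δ
  | .atom A => I.atom A
  | .top => Set.univ
  | .bot => ∅
  | .and C D => C.sem I ∩ D.sem I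
  | .or C D => C.sem I ∪ D.sem I
  | .neg C => (C.sem I)ᶜ
  | .ex S C => {d | ∃ e, S.sem I d e ∧ e ∈ C.sem I}
  | .all S C => {d | ∀ e, S.sem I d e → e ∈ C.sem I}
  | .atLeast k S C => {d | ∃ s : Finset I.Δ, s.card = k ∧ ∀ e ∈ s, S.sem I d e ∧ e ∈ C.sem I}

/-! ### Concept languages L(Os)[SC, SR] -/

def Role.inSig (Os : Finset Op) (SR : Finset ℕ) : Role → Prop
  | .name R => R ∈ SR
  | .inv R  => Op.inv ∈ Os ∧ R ∈ SR

/-- Membership of a concept in the language `L(Os)[SC, SR]`. -/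
def Concept.inLang (Os : Finset Op) (SC SR : Finset ℕ) : Concept → Prop
  | .atom A => A ∈ SC
  | .top => Op.top ∈ Os
  | .bot => Op.bot ∈ Os
  | .and C D => Op.and ∈ Os ∧ C.inLang Os SC SR ∧ D.inLang Os SC SR
  | .or C D => Op.or ∈ Os ∧ C.inLang Os SC SR ∧ D.inLang Os SC SR
  | .neg C => Op.neg ∈ Os ∧ C.inLang Os SC SR
  | .ex S C => Op.ex ∈ Os ∧ S.inSig Os SR ∧ C.inLang Os SC SR
  | .all S C => Op.all ∈ Os ∧ S.inSig Os SR ∧ C.inLang Os SC SR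
  | .atLeast k S C => Op.ge ∈ Os ∧ 1 ≤ k ∧ S.inSig Os SR ∧ C.inLang Os SC SR

/-! ### DL-Lite ontologies -/

/-- Basic concepts: concept names, ∃R and ∃R⁻. -/
inductive Basic where
  | atom : ℕ → Basic
  | ex : Role → Basic
deriving DecidableEq

def Basic.sem (I : Interp) : Basic → Set I.Δ
  | .atom A => I.atom A
  | .ex S => {d | ∃ e, S.sem I d e}

/-- A DL-Lite concept inclusion `B ⊑ C` where `C` is a basic concept
(`negated = false`) or a negated basic concept (`negated = true`). -/
structure CI where
  lhs : Basic
  rhs : Basic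
  negated : Bool
deriving DecidableEq

def CI.sat (I : Interp) (ci : CI) : Prop :=
  if ci.negated then ci.lhs.sem I ⊆ (ci.rhs.sem I)ᶜ else ci.lhs.sem I ⊆ ci.rhs.sem I

/-- A DL-Lite ontology: a finite set (list) of concept inclusions. -/
abbrev Ontology := List CI

def Interp.satO (I : Interp) (Ont : Ontology) : Prop := ∀ ci ∈ Ont, ci.sat I

/-! ### Pointed interpretations, examples, characterisations -/

structure PInterp where
  I : Interp
  pt : I.Δ

/-- A pointed interpretation is finite if its domain is finite. -/
def PInterp.finite (P : PInterp) : Prop := Finite P.I.Δ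

/-- `C` fits a collection `(Epos, Eneg)` of labelled examples. -/
def Fits (C : Concept) (Epos Eneg : List PInterp) : Prop :=
  (∀ e ∈ Epos, e.pt ∈ C.sem e.I) ∧ (∀ e ∈ Eneg, e.pt ∉ C.sem e.I)

/-- Equivalence of concepts. -/
def CEquiv (C D : Concept) : Prop := ∀ I : Interp, C.sem I = D.sem I

/-- Equivalence of concepts relative to an ontology. -/
def CEquivO (Ont : Ontology) (C D : Concept) : Prop :=
  ∀ I : Interp, I.satO Ont → C.sem I = D.sem I

/-- `⊨ C ⊑ D`. -/
def Subsumes (C D : Concept) : Prop := ∀ I : Interp, C.sem I ⊆ D.sem I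

/-- `Ont ⊨ C ⊑ D`. -/
def SubsumesO (Ont : Ontology) (C D : Concept) : Prop :=
  ∀ I : Interp, I.satO Ont → C.sem I ⊆ D.sem I

/-- `(Epos, Eneg)` is a finite characterisation of `C` w.r.t. the
concept language (predicate) `L`: all examples are finite, `C` fits,
and every fitting concept of `L` is equivalent to `C`. -/
def FinChar (L : Concept → Prop) (C : Concept) (Epos Eneg : List PInterp) : Prop :=
  (∀ e ∈ Epos ++ Eneg, e.finite) ∧
  Fits C Epos Eneg ∧
  ∀ D, L D → Fits D Epos Eneg → CEquiv C D

/-- Finite characterisation of `C` w.r.t. `L` under an ontology `Ont`: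
all examples are finite and satisfy `Ont`, `C` fits, and every fitting
concept of `L` is equivalent to `C` relative to `Ont`. -/
def FinCharO (Ont : Ontology) (L : Concept → Prop) (C : Concept)
    (Epos Eneg : List PInterp) : Prop :=
  (∀ e ∈ Epos ++ Eneg, e.finite ∧ e.I.satO Ont) ∧
  Fits C Epos Eneg ∧
  ∀ D, L D → Fits D Epos Eneg → CEquivO Ont C D

/-- `L(Os)` admits finite characterisations. -/
def AdmitsFinChar (Os : Finset Op) : Prop :=
  ∀ SC SR : Finset ℕ, ∀ C : Concept, C.inLang Os SC SR →
    ∃ Epos Eneg : List PInterp, FinChar (Concept.inLang Os SC SR) C Epos Eneg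

/-- `L(Os)` admits finite characterisations under the ontology `Ont`. -/
def AdmitsFinCharO (Os : Finset Op) (Ont : Ontology) : Prop :=
  ∀ SC SR : Finset ℕ, ∀ C : Concept, C.inLang Os SC SR →
    ∃ Epos Eneg : List PInterp, FinCharO Ont (Concept.inLang Os SC SR) C Epos Eneg

/-! ### Size, role depth, number restrictions -/

/-- Number of symbols of a concept expression (numbers in binary). -/
def Concept.size : Concept → ℕ
  | .atom _ => 1
  | .top => 1
  | .bot => 1
  | .and C D => C.size + D.size + 1
  | .or C D => C.size + D.size + 1
  | .neg C => C.size + 1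
  | .ex _ C => C.size + 2
  | .all _ C => C.size + 2
  | .atLeast k _ C => C.size + 2 + Nat.size k

/-- Role depth of a concept. -/
def Concept.dp : Concept → ℕ
  | .atom _ => 0
  | .top => 0
  | .bot => 0
  | .and C D => max C.dp D.dp
  | .or C D => max C.dp D.dp
  | .neg C => C.dp
  | .ex _ C => C.dp + 1
  | .all _ C => C.dp + 1
  | .atLeast _ _ C => C.dp + 1

/-- The largest number occurring in a number restriction of `C` (0 if none). -/
def Concept.nr : Concept → ℕ
  | .atom _ => 0
  | .top => 0
  | .bot => 0
  | .and C D => max C.nr D.nr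
  | .or C D => max C.nr D.nr
  | .neg C => C.nr
  | .ex _ C => C.nr
  | .all _ C => C.nr
  | .atLeast k _ C => max k C.nr

/-- The operator set of `L(≥,⊓,⊤)`. -/
def ELQops : Finset Op := {Op.ge, Op.and, Op.top}

/-- Conjunction of a list of concepts (the empty conjunction denoting `⊤`). -/
def bigConj (l : List Concept) : Concept := l.foldr Concept.and Concept.top

theorem mem_sem_bigConj (I : Interp) (d : I.Δ) (l : List Concept) :
    d ∈ (bigConj l).sem I ↔ ∀ C ∈ l, d ∈ C.sem I := by
  induction l with
  | nil => simp [bigConj, Concept.sem]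
  | cons C l ih =>
    rw [List.forall_mem_cons, ← ih]
    rfl

theorem mem_sem_conjunction (I : Interp) (d : I.Δ) (as : List ℕ)
    (qs : List (ℕ × ℕ × Concept)) :
    d ∈ (bigConj (as.map Concept.atom ++
        qs.map (fun q => Concept.atLeast q.1 (Role.name q.2.1) q.2.2))).sem I ↔
      (∀ A ∈ as, d ∈ I.atom A) ∧
      ∀ q ∈ qs, d ∈ (Concept.atLeast q.1 (Role.name q.2.1) q.2.2).sem I := by
  rw [mem_sem_bigConj, List.forall_mem_append, List.forall_mem_map, List.forall_mem_map]
  rfl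

theorem mem_sem_atLeast_of_injective {I : Interp} {k : ℕ} {S : Role} {C : Concept} {d : I.Δ}
    (g : ℕ → I.Δ) (hg : Function.Injective g)
    (h : ∀ n < k, S.sem I d (g n) ∧ g n ∈ C.sem I) :
    d ∈ (Concept.atLeast k S C).sem I := by
  refine ⟨(Finset.range k).map ⟨g, hg⟩, by simp, ?_⟩
  intro e he
  obtain ⟨n, hn, rfl⟩ := Finset.mem_map.1 he
  exact h n (Finset.mem_range.1 hn)

theorem sem_atLeast_mono {I : Interp} {k k' : ℕ} {S : Role} {C C' : Concept}
    (hk : k' ≤ k) (hC : Subsumes C C') :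
    (Concept.atLeast k S C).sem I ⊆ (Concept.atLeast k' S C').sem I := by
  rintro d ⟨s, hs, h⟩
  obtain ⟨t, hts, ht⟩ := Finset.exists_subset_card_eq (hs ▸ hk)
  exact ⟨t, ht, fun e he => ⟨(h e (hts he)).1, hC I (h e (hts he)).2⟩⟩

/-- Embeddings onto successor-closed parts preserve and reflect concepts of `L(≥,⊓,⊤)`. -/
theorem mem_sem_map_iff {I J : Interp} (f : I.Δ → J.Δ) (hf : Function.Injective f)
    (hatom : ∀ A d, f d ∈ J.atom A ↔ d ∈ I.atom A)
    (hrel : ∀ R d y, J.rel R (f d) y ↔ ∃ e, f e = y ∧ I.rel R d e)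
    {SC SR : Finset ℕ} (C : Concept) (hC : C.inLang ELQops SC SR) (d : I.Δ) :
    f d ∈ C.sem J ↔ d ∈ C.sem I := by
  classical
  induction C generalizing d with
  | atom A => exact hatom A d
  | top => simp [Concept.sem]
  | bot => simp [Concept.inLang, ELQops] at hC
  | and C D ihC ihD => exact and_congr (ihC hC.2.1 d) (ihD hC.2.2 d)
  | or C D => simp [Concept.inLang, ELQops] at hC
  | neg C => simp [Concept.inLang, ELQops] at hC
  | ex S C => simp [Concept.inLang, ELQops] at hC
  | all S C => simp [Concept.inLang, ELQops] at hC
  | atLeast k S C ih =>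
    obtain ⟨-, -, hS, hC⟩ := hC
    cases S with
    | inv R => simp [Role.inSig, ELQops] at hS
    | name R =>
      constructor
      · rintro ⟨s, hs, h⟩
        have hrange : ∀ y ∈ s, y ∈ Set.range f := fun y hy => by
          obtain ⟨e, he, -⟩ := (hrel R d y).1 (h y hy).1
          exact ⟨e, he⟩
        refine ⟨s.preimage f hf.injOn, ?_, ?_⟩
        · rw [Finset.card_preimage, Finset.filter_true_of_mem hrange, hs]
        · intro e he
          obtain ⟨hr, hm⟩ := h (f e) (Finset.mem_preimage.1 he)
          obtain ⟨e', he', hr'⟩ := (hrel R d (f e)).1 hr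
          exact ⟨hf he' ▸ hr', (ih hC e).1 hm⟩
      · rintro ⟨s, hs, h⟩
        refine ⟨s.map ⟨f, hf⟩, by simp [hs], ?_⟩
        intro y hy
        obtain ⟨e, he, rfl⟩ := Finset.mem_map.1 hy
        exact ⟨(hrel R d (f e)).2 ⟨e, rfl, (h e he).1⟩, (ih hC e).2 (h e he).2⟩

/-- The complete interpretation on `ℕ`, all of whose elements satisfy every concept of
`L(≥,⊓,⊤)`. -/
def Interp.complete : Interp where
  Δ := ℕ
  dom_nonempty := ⟨0⟩
  atom _ := Set.univ
  rel _ _ _ := True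

theorem mem_sem_complete {SC SR : Finset ℕ} (C : Concept) (hC : C.inLang ELQops SC SR) (n : ℕ) :
    n ∈ C.sem Interp.complete := by
  induction C generalizing n with
  | atom A => exact Set.mem_univ n
  | top => exact Set.mem_univ n
  | bot => simp [Concept.inLang, ELQops] at hC
  | and C D ihC ihD => exact ⟨ihC hC.2.1 n, ihD hC.2.2 n⟩
  | or C D => simp [Concept.inLang, ELQops] at hC
  | neg C => simp [Concept.inLang, ELQops] at hC
  | ex S C => simp [Concept.inLang, ELQops] at hC
  | all S C => simp [Concept.inLang, ELQops] at hC
  | atLeast k S C ih =>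
    refine mem_sem_atLeast_of_injective (I := Interp.complete) id Function.injective_id ?_
    intro m _
    exact ⟨by cases S <;> trivial, ih hC.2.2.2 m⟩

/-- The domain of `Interp.rooted`. -/
inductive RootedDomain {ι : Type} (P : ι → PInterp) : Type where
  | root : RootedDomain P
  | full : ℕ → RootedDomain P
  | copy : (i : ι) → ℕ → (P i).I.Δ → RootedDomain P

/-- A fresh root placed above the complete interpretation and above countably many disjoint copies
of every `P i`. The root satisfies the concept names in `as`, its `R`-successors in the complete
part are those `n` with `N R n`, and all copies of the points of the `P i` are `R`-successors of
the root for every `R`. -/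
def Interp.rooted (as : List ℕ) (N : ℕ → ℕ → Prop) {ι : Type} (P : ι → PInterp) : Interp where
  Δ := RootedDomain P
  dom_nonempty := ⟨.root⟩
  atom A := {x | match x with
    | .root => A ∈ as
    | .full _ => True
    | .copy i _ e => e ∈ (P i).I.atom A}
  rel R x y := match x with
    | .root => (∃ n, y = .full n ∧ N R n) ∨ ∃ i n, y = .copy i n (P i).pt
    | .full _ => ∃ m, .full m = y
    | .copy i n d => ∃ e, .copy i n e = y ∧ (P i).I.rel R d e

theorem full_mem_sem_rooted (as : List ℕ) (N : ℕ → ℕ → Prop) {ι : Type} (P : ι → PInterp)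
    {SC SR : Finset ℕ} {C : Concept} (hC : C.inLang ELQops SC SR) (n : ℕ) :
    RootedDomain.full n ∈ C.sem (Interp.rooted as N P) := by
  refine (mem_sem_map_iff (I := Interp.complete) (J := Interp.rooted as N P)
    RootedDomain.full (fun a b h => by cases h; rfl) (fun A d => Iff.rfl) ?_ C hC n).2
    (mem_sem_complete C hC n)
  intro R d y
  exact ⟨fun ⟨m, h⟩ => ⟨m, h, trivial⟩, fun ⟨m, h, _⟩ => ⟨m, h⟩⟩

theorem copy_mem_sem_rooted_iff (as : List ℕ) (N : ℕ → ℕ → Prop) {ι : Type} (P : ι → PInterp)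
    {SC SR : Finset ℕ} {C : Concept} (hC : C.inLang ELQops SC SR) (i : ι) (n : ℕ)
    (e : (P i).I.Δ) :
    RootedDomain.copy i n e ∈ C.sem (Interp.rooted as N P) ↔ e ∈ C.sem (P i).I :=
  mem_sem_map_iff (I := (P i).I) (J := Interp.rooted as N P)
    (RootedDomain.copy i n) (fun a b h => by cases h; rfl) (fun _ _ => Iff.rfl)
    (fun _ _ _ => Iff.rfl) C hC e

theorem exists_counterexample {C D : Concept} (h : ¬ Subsumes C D) :
    ∃ P : PInterp, P.pt ∈ C.sem P.I ∧ P.pt ∉ D.sem P.I := by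
  simp only [Subsumes, Set.subset_def, not_forall] at h
  obtain ⟨I, d, hC, hD⟩ := h
  exact ⟨⟨I, d⟩, hC, hD⟩

/-- A number restriction entailed by a conjunction is entailed by one of its conjuncts. -/
theorem exists_conjunct_of_forall_mem_sem {SC SR : Finset ℕ} {as : List ℕ}
    {qs : List (ℕ × ℕ × Concept)} {k R : ℕ} {D : Concept}
    (hqs : ∀ q ∈ qs, q.2.2.inLang ELQops SC SR)
    (hk : 1 ≤ k) (hD : D.inLang ELQops SC SR)
    (h : ∀ (I : Interp) (d : I.Δ), (∀ A ∈ as, d ∈ I.atom A) →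
      (∀ q ∈ qs, d ∈ (Concept.atLeast q.1 (Role.name q.2.1) q.2.2).sem I) →
      d ∈ (Concept.atLeast k (Role.name R) D).sem I) :
    ∃ q ∈ qs, k ≤ q.1 ∧ q.2.1 = R ∧ Subsumes q.2.2 D := by
  by_contra! hno
  let ι : Type := {q : ℕ × ℕ × Concept // q ∈ qs ∧ ¬ Subsumes q.2.2 D}
  choose P hP using fun i : ι => exists_counterexample i.2.2
  let I := Interp.rooted as (fun S n => S = R → n < k - 1) P
  obtain ⟨s, hs, hsD⟩ := h I RootedDomain.root (fun A hA => hA) (by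
    intro q hq
    by_cases hsub : Subsumes q.2.2 D
    · refine mem_sem_atLeast_of_injective (I := I) RootedDomain.full
        (fun a b h => by cases h; rfl) fun n hn =>
        ⟨Or.inl ⟨n, rfl, fun hR => ?_⟩, full_mem_sem_rooted as _ P (hqs q hq) n⟩
      have : ¬ k ≤ q.1 := fun hle => hno q hq hle hR hsub
      omega
    · let i : ι := ⟨q, hq, hsub⟩
      exact mem_sem_atLeast_of_injective (I := I) (fun n => RootedDomain.copy i n (P i).pt)
        (fun a b h => by cases h; rfl) fun n _ =>
        ⟨Or.inr ⟨i, n, rfl⟩, (copy_mem_sem_rooted_iff as _ P (hqs q hq) i n _).2 (hP i).1⟩)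
  have hsub : s ⊆ (Finset.range (k - 1)).map
      ⟨RootedDomain.full (P := P), fun a b h => by cases h; rfl⟩ := by
    intro y hy
    obtain ⟨hr, hm⟩ := hsD y hy
    rcases hr with ⟨n, rfl, hn⟩ | ⟨i, n, rfl⟩
    · exact Finset.mem_map.2 ⟨n, Finset.mem_range.2 (hn rfl), rfl⟩
    · exact absurd ((copy_mem_sem_rooted_iff as _ P hD i n _).1 hm) (hP i).2
  have hcard := Finset.card_le_card hsub
  rw [Finset.card_map, Finset.card_range] at hcard
  have : s.card = k := hs
  omega

/-- **Lemma (subsumption for `L(≥,⊓,⊤)`)**: for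
`C = A_1 ⊓ ⋯ ⊓ A_m ⊓ ⨅_i (≥ k_i R_i.C_i)` and
`C' = A'_1 ⊓ ⋯ ⊓ A'_{m'} ⊓ ⨅_j (≥ k'_j R'_j.C'_j)`,
`⊨ C ⊑ C'` iff every `A'_j` is among the `A_i`, and every conjunct
`≥ k'_j R'_j.C'_j` is matched by some conjunct `≥ k_i R_i.C_i` with
`k_i ≥ k'_j`, `R_i = R'_j`, and `⊨ C_i ⊑ C'_j`.
Conjuncts `≥ k R.C` are encoded as triples `(k, R, C)`. -/
theorem ELQ_subsumption_characterisation (SC SR : Finset ℕ)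
    (as as' : List ℕ) (qs qs' : List (ℕ × ℕ × Concept))
    (has : ∀ A ∈ as, A ∈ SC) (has' : ∀ A ∈ as', A ∈ SC)
    (hqs : ∀ q ∈ qs, 1 ≤ q.1 ∧ q.2.1 ∈ SR ∧ Concept.inLang ELQops SC SR q.2.2)
    (hqs' : ∀ q ∈ qs', 1 ≤ q.1 ∧ q.2.1 ∈ SR ∧ Concept.inLang ELQops SC SR q.2.2) :
    Subsumes
      (bigConj (as.map Concept.atom ++
        qs.map (fun q => Concept.atLeast q.1 (Role.name q.2.1) q.2.2)))
      (bigConj (as'.map Concept.atom ++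
        qs'.map (fun q => Concept.atLeast q.1 (Role.name q.2.1) q.2.2)))
    ↔ ((∀ A ∈ as', A ∈ as) ∧
        ∀ q' ∈ qs', ∃ q ∈ qs, q'.1 ≤ q.1 ∧ q.2.1 = q'.2.1 ∧ Subsumes q.2.2 q'.2.2) := by
  constructor
  · intro h
    have h' : ∀ (I : Interp) (d : I.Δ), (∀ A ∈ as, d ∈ I.atom A) →
        (∀ q ∈ qs, d ∈ (Concept.atLeast q.1 (Role.name q.2.1) q.2.2).sem I) →
        (∀ A ∈ as', d ∈ I.atom A) ∧
        ∀ q ∈ qs', d ∈ (Concept.atLeast q.1 (Role.name q.2.1) q.2.2).sem I :=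
      fun I d h₁ h₂ => (mem_sem_conjunction I d as' qs').1
        (h I ((mem_sem_conjunction I d as qs).2 ⟨h₁, h₂⟩))
    constructor
    · let I := Interp.rooted as (fun _ _ => True) Empty.elim
      refine (h' I RootedDomain.root (fun A hA => hA) fun q hq => ?_).1
      exact mem_sem_atLeast_of_injective (I := I) RootedDomain.full
        (fun a b h => by cases h; rfl) fun n _ =>
        ⟨Or.inl ⟨n, rfl, trivial⟩, full_mem_sem_rooted as _ _ (hqs q hq).2.2 n⟩
    · intro q' hq'
      exact exists_conjunct_of_forall_mem_sem (fun q hq => (hqs q hq).2.2) (hqs' q' hq').1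
        (hqs' q' hq').2.2 fun I d h₁ h₂ => (h' I d h₁ h₂).2 q' hq'
  · rintro ⟨hatoms, hres⟩ I d hd
    obtain ⟨h₁, h₂⟩ := (mem_sem_conjunction I d as qs).1 hd
    refine (mem_sem_conjunction I d as' qs').2 ⟨fun A hA => h₁ A (hatoms A hA), ?_⟩
    intro q' hq'
    obtain ⟨q, hq, hk, hR, hsub⟩ := hres q' hq'
    exact sem_atLeast_mono hk hsub (hR ▸ h₂ q hq)

end DL
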